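/- arXiv:1706.04283 — 2 statements merged into one kernel-verified Lean document; each statement's English description precedes it below -/
import Mathlib

section
/- Let q be a prime power, m a positive integer, and F = 𝔽_{q^m}. Let b_1, …, b_n ∈ F^* and set a_j = b_j^{q−1} for each j. Then the family (a_1, …, a_n) is right independent if and only if (b_1, …, b_n) is linearly independent over the subfield 𝔽_q of F. -/
/-- `⟦i⟧ = ∑_{j=0}^{i-1} q^j = (q^i - 1)/(q - 1)`. -/
def qbrack (q i : ℕ) : ℕ := ∑ j ∈ Finset.range i, q ^ j

/-- `(a_1, …, a_n)` is right independent: the only coefficient tuple whose right evaluation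
vanishes at every `a_j` is zero. -/
def RightIndep (q : ℕ) {F : Type*} [Field F] {n : ℕ} (a : Fin n → F) : Prop :=
  ∀ f : Fin n → F,
    (∀ j : Fin n, ∑ i : Fin n, f i * (a j) ^ qbrack q (i : ℕ) = 0) → f = 0

theorem qbrack_succ (q i : ℕ) : qbrack q (i + 1) = qbrack q i + q ^ i :=
  Finset.sum_range_succ _ _

theorem sub_one_mul_qbrack_add_one {q : ℕ} (hq : 0 < q) (i : ℕ) :
    (q - 1) * qbrack q i + 1 = q ^ i := by
  obtain ⟨r, rfl⟩ := Nat.exists_eq_succ_of_ne_zero hq.ne'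
  induction i with
  | zero => simp [qbrack]
  | succ i ih =>
    rw [qbrack_succ, pow_succ, ← ih]
    simp only [Nat.succ_eq_add_one, Nat.add_sub_cancel] at ih ⊢
    ring

/-- If `φ` is a bijective endomorphism of a field and the `b j`, `j ∈ s`, are linearly independent
over the fixed field of `φ`, then the columns of the Moore matrix `(φ^i (b j))`, `i < |s|`, `j ∈ s`,
are linearly independent. -/
theorem eq_zero_of_sum_mul_iterate_eq_zero {F ι : Type*} [Field F] (φ : F →+* F)
    (hφ : Function.Surjective φ) (b : ι → F) (s : Finset ι)
    (hb : ∀ c : ι → F, (∀ j ∈ s, φ (c j) = c j) → ∑ j ∈ s, c j * b j = 0 → ∀ j ∈ s, c j = 0)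
    (c : ι → F) (hc : ∀ i < s.card, ∑ j ∈ s, c j * φ^[i] (b j) = 0) :
    ∀ j ∈ s, c j = 0 := by
  classical
  induction s using Finset.induction_on generalizing c with
  | empty => simp
  | insert k s hk ih =>
    have hbs : ∀ c : ι → F, (∀ j ∈ s, φ (c j) = c j) → ∑ j ∈ s, c j * b j = 0 →
        ∀ j ∈ s, c j = 0 := by
      intro c hfix hsum j hj
      have hne : ∀ l ∈ s, l ≠ k := fun l hl h => hk (h ▸ hl)
      have h := hb (Function.update c k 0) (fun l _ => by
          by_cases hlk : l = k
          · subst hlk; simp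
          · have : l ∈ s := by grind
            simpa [hlk] using hfix l this) (by
          rw [Finset.sum_insert hk]
          simp only [Function.update_self, zero_mul, zero_add]
          rw [← hsum]
          exact Finset.sum_congr rfl fun l hl => by simp [hne l hl]) j
          (Finset.mem_insert_of_mem hj)
      simpa [hne j hj] using h
    rw [Finset.card_insert_of_notMem hk] at hc
    by_cases hck : c k = 0
    · have h := ih hbs c fun i hi => by
        simpa [Finset.sum_insert hk, hck] using hc i (by omega)
      simpa [hck] using h
    · exfalso
      have hc' : ∀ i < s.card + 1, φ^[i] (b k) + ∑ j ∈ s, c j / c k * φ^[i] (b j) = 0 := by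
        intro i hi
        have h := hc i hi
        rw [Finset.sum_insert hk] at h
        have h2 : ∑ j ∈ s, c j / c k * φ^[i] (b j) = (∑ j ∈ s, c j * φ^[i] (b j)) / c k := by
          rw [Finset.sum_div]
          exact Finset.sum_congr rfl fun j _ => by ring
        rw [h2]
        field_simp
        linear_combination h
      choose e he using fun j => hφ (φ (c j / c k) - c j / c k)
      have he0 : ∀ j ∈ s, e j = 0 := by
        refine ih hbs e fun i hi => φ.injective ?_
        have h1 := congrArg φ (hc' i (by omega))
        have h2 := hc' (i + 1) (by omega)
        simp only [map_add, map_sum, map_mul, map_zero, ← Function.iterate_succ_apply'] at h1 ⊢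
        simp only [he, sub_mul, Finset.sum_sub_distrib]
        linear_combination h1 - h2
      have hfix : ∀ j ∈ insert k s, φ (c j / c k) = c j / c k := by
        intro j hj
        rcases Finset.mem_insert.1 hj with rfl | hj
        · simp [div_self hck]
        · have h := he j
          rw [he0 j hj, map_zero] at h
          exact (sub_eq_zero.1 h.symm)
      have h := hb (fun j => c j / c k) hfix (by
        rw [Finset.sum_insert hk]
        simpa [div_self hck] using hc' 0 (by omega)) k (Finset.mem_insert_self k s)
      exact one_ne_zero ((div_self hck).symm.trans h)

/-- With `a_j = b_j^{q-1}`, the family `(a_1, …, a_n)` is right independent iff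
`(b_1, …, b_n)` is linearly independent over the subfield `𝔽_q = {c : c^q = c}` of `F`. -/
theorem rightIndep_iff_linearIndependent (q m : ℕ) (hq : IsPrimePow q) (hm : 0 < m)
    (F : Type*) [Field F] [Fintype F] (hF : Fintype.card F = q ^ m)
    (n : ℕ) (b : Fin n → F) (hb : ∀ j, b j ≠ 0)
    (a : Fin n → F) (ha : ∀ j, a j = (b j) ^ (q - 1)) :
    RightIndep q a ↔
      (∀ c : Fin n → F, (∀ j, (c j) ^ q = c j) → ∑ j, c j * b j = 0 → c = 0) := by
  obtain ⟨p, k, hp, -, rfl⟩ := hq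
  have : Fact p.Prime := ⟨hp.nat_prime⟩
  have : CharP F p := charP_of_card_eq_prime_pow (f := k * m) (by rw [hF, pow_mul])
  set φ := iterateFrobenius F p k
  have hφ (x : F) : φ x = x ^ p ^ k := iterateFrobenius_def p k x
  have hφi (i : ℕ) (x : F) : φ^[i] x = x ^ (p ^ k) ^ i := by
    induction i with
    | zero => simp
    | succ i ih => rw [Function.iterate_succ_apply', ih, hφ, ← pow_mul, pow_succ]
  have hsurj : Function.Surjective φ := Finite.surjective_of_injective φ.injective
  let M : Matrix (Fin n) (Fin n) F := .of fun j i => φ^[i] (b j)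
  have hab (i : ℕ) (j : Fin n) : a j ^ qbrack (p ^ k) i * b j = φ^[i] (b j) := by
    rw [ha, ← pow_mul, ← pow_succ, sub_one_mul_qbrack_add_one (pow_pos hp.nat_prime.pos k), hφi]
  have hright : RightIndep (p ^ k) a ↔ M.det ≠ 0 := by
    rw [← not_iff_not, not_not, ← Matrix.exists_mulVec_eq_zero_iff]
    have hiff (f : Fin n → F) :
        (∀ j, ∑ i : Fin n, f i * a j ^ qbrack (p ^ k) i = 0) ↔ M.mulVec f = 0 := by
      rw [funext_iff]
      refine forall_congr' fun j => ?_
      have h : M.mulVec f j = (∑ i : Fin n, f i * a j ^ qbrack (p ^ k) i) * b j := by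
        simp only [Matrix.mulVec, dotProduct, M, Matrix.of_apply, Finset.sum_mul, ← hab]
        exact Finset.sum_congr rfl fun i _ => by ring
      simp [h, hb j]
    simp only [RightIndep, hiff]
    push Not
    exact exists_congr fun f => and_comm
  have hvec (c : Fin n → F) :
      M.vecMul c = 0 ↔ ∀ i : Fin n, ∑ j, c j * φ^[i] (b j) = 0 := by
    simp [funext_iff, Matrix.vecMul, dotProduct, M]
  rw [hright]
  constructor
  · intro hdet c hc hsum
    refine Matrix.eq_zero_of_vecMul_eq_zero hdet ((hvec c).2 fun i => ?_)
    have hfix : ∀ j, φ^[i] (c j) = c j := fun j =>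
      Function.iterate_fixed ((hφ _).trans (hc j)) i
    have h := congrArg (φ^[i]) hsum
    simp only [← RingHom.coe_pow] at hfix h ⊢
    simpa only [map_sum, map_mul, map_zero, hfix] using h
  · intro hind hdet
    obtain ⟨c, hc0, hc⟩ := Matrix.exists_vecMul_eq_zero_iff.2 hdet
    refine hc0 (funext fun j => ?_)
    refine eq_zero_of_sum_mul_iterate_eq_zero φ hsurj b Finset.univ ?_ c ?_ j (Finset.mem_univ j)
    · intro d hd hsum l _
      exact congrFun (hind d (fun j => (hφ _).symm.trans (hd j (Finset.mem_univ j))) hsum) l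
    · intro i hi
      exact (hvec c).1 hc ⟨i, by simpa using hi⟩
end

section
/- Let q be a prime power, m a positive integer, F = 𝔽_{q^m}, and let K be an algebraic closure of F. Let 0 ≤ k ≤ n with n ≥ 1, and let f_k, …, f_n ∈ F with f_k ≠ 0 and f_n ≠ 0, and let P(y) = ∑_{i=k}^{n} f_i y^{⟦i⟧} ∈ F[y]. Then in K, the polynomial P has 0 as a root of multiplicity ⟦k⟧ (when k ≥ 1), has exactly ⟦n−k⟧ = (q^{n−k} − 1)/(q − 1) distinct nonzero roots, and each nonzero root has multiplicity exactly q^k. -/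
open Polynomial

open scoped Classical

theorem qbrack_add (q k i : ℕ) : qbrack q (k + i) = qbrack q k + qbrack q i * q ^ k := by
  simp only [qbrack, Finset.sum_range_add, Finset.sum_mul]
  congr 1
  exact Finset.sum_congr rfl fun j _ => by ring

theorem qbrack_strictMono {q : ℕ} (hq : 0 < q) : StrictMono (qbrack q) :=
  strictMono_nat_of_lt_succ fun i => by
    simp only [qbrack, Finset.sum_range_succ]
    exact Nat.lt_add_of_pos_right (pow_pos hq i)

theorem natCast_qbrack_succ {R : Type*} [Semiring R] {q : ℕ} (hq : (q : R) = 0) (i : ℕ) :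
    (qbrack q (i + 1) : R) = 1 := by
  simp [qbrack, Finset.sum_range_succ', pow_succ, hq]

theorem qbrack_zero (q : ℕ) : qbrack q 0 = 0 := rfl

/-- The polynomial `∑_{i=0}^{N} c_i X^⟦i⟧`. -/
noncomputable def qbrackPoly {R : Type*} [Semiring R] (q : ℕ) (c : ℕ → R) (N : ℕ) : R[X] :=
  ∑ i ∈ Finset.range (N + 1), C (c i) * X ^ qbrack q i

theorem natDegree_qbrackPoly {R : Type*} [Semiring R] {q : ℕ} (hq : 0 < q) {c : ℕ → R} {N : ℕ}
    (hc : c N ≠ 0) : (qbrackPoly q c N).natDegree = qbrack q N := by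
  refine natDegree_eq_of_le_of_coeff_ne_zero ?_ ?_
  · refine natDegree_sum_le_of_forall_le _ _ fun i hi => (natDegree_C_mul_X_pow_le _ _).trans ?_
    exact (qbrack_strictMono hq).monotone (Nat.lt_succ_iff.mp (Finset.mem_range.mp hi))
  · rw [qbrackPoly, finsetSum_coeff, Finset.sum_eq_single N]
    · simpa using hc
    · intro i _ hi
      rw [coeff_C_mul_X_pow, if_neg fun h => hi ((qbrack_strictMono hq).injective h).symm]
    · simp

theorem separable_qbrackPoly {K : Type*} [Field K] {q : ℕ} (hq : (q : K) = 0) {c : ℕ → K} {N : ℕ}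
    (hc : c 0 ≠ 0) : (qbrackPoly q c N).Separable := by
  have key : qbrackPoly q c N - X * derivative (qbrackPoly q c N) = C (c 0) := by
    simp only [qbrackPoly, Finset.sum_range_succ', derivative_add, derivative_sum, qbrack_zero,
      derivative_C_mul_X_pow, natCast_qbrack_succ hq, mul_add, Finset.mul_sum]
    have hterm (i : ℕ) : X * (C (c (i + 1) * 1) * X ^ (qbrack q (i + 1) - 1)) =
        C (c (i + 1)) * X ^ qbrack q (i + 1) := by
      have hpos : qbrack q (i + 1) = qbrack q (i + 1) - 1 + 1 := by
        simp [qbrack, Finset.sum_range_succ']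
      conv_rhs => rw [hpos, pow_succ]
      rw [mul_one]
      ring
    simp only [hterm]
    simp
  refine ⟨C (c 0)⁻¹, -(C (c 0)⁻¹ * X), ?_⟩
  calc _ = C (c 0)⁻¹ * (qbrackPoly q c N - X * derivative (qbrackPoly q c N)) := by ring
    _ = 1 := by rw [key, ← C_mul, inv_mul_cancel₀ hc, C_1]

theorem sum_Icc_qbrack_eq {K : Type*} [Field K] {p s : ℕ} [ExpChar K p] {k n : ℕ} (hkn : k ≤ n)
    (c g : ℕ → K) (hc : ∀ i, c i ^ (p ^ s) ^ k = g (k + i)) :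
    ∑ i ∈ Finset.Icc k n, C (g i) * X ^ qbrack (p ^ s) i =
      X ^ qbrack (p ^ s) k * qbrackPoly (p ^ s) c (n - k) ^ (p ^ s) ^ k := by
  obtain ⟨N, rfl⟩ := Nat.exists_eq_add_of_le hkn
  have hpow : qbrackPoly (p ^ s) c N ^ (p ^ s) ^ k =
      ∑ i ∈ Finset.range (N + 1), (C (c i) * X ^ qbrack (p ^ s) i) ^ (p ^ s) ^ k := by
    simp only [qbrackPoly, ← pow_mul p s k, ← iterateFrobenius_def, map_sum]
  rw [Nat.add_sub_cancel_left, hpow, Finset.mul_sum, ← Finset.Ico_add_one_right_eq_Icc,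
    Finset.sum_Ico_eq_sum_range]
  refine Finset.sum_congr (by congr 1; omega) fun i _ => ?_
  rw [qbrack_add, ← hc, mul_pow, pow_add, ← pow_mul, C_pow]
  ring

/-- If `f_k ≠ 0` and `f_n ≠ 0` (`k ≤ n`, `n ≥ 1`), then over an algebraic closure `K` of
`F = 𝔽_{q^m}` the right evaluation polynomial `P(y) = ∑_{i=k}^n f_i y^⟦i⟧` has `0` as a
root of multiplicity `⟦k⟧`, has exactly `⟦n-k⟧` distinct nonzero roots, and every nonzero
root has multiplicity exactly `q^k`. -/
theorem eval_poly_root_structure (q m : ℕ) (hq : IsPrimePow q) (hm : 0 < m)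
    (F : Type*) [Field F] [Fintype F] (hF : Fintype.card F = q ^ m)
    (K : Type*) [Field K] [Algebra F K] [IsAlgClosure F K]
    (k n : ℕ) (hkn : k ≤ n) (hn : 1 ≤ n)
    (f : ℕ → F) (hfk : f k ≠ 0) (hfn : f n ≠ 0)
    (P : F[X]) (hP : P = ∑ i ∈ Finset.Icc k n, C (f i) * X ^ qbrack q i) :
    (P.map (algebraMap F K)).rootMultiplicity 0 = qbrack q k ∧
    ((P.map (algebraMap F K)).roots.toFinset.erase 0).card = qbrack q (n - k) ∧
    (∀ a : K, a ≠ 0 → (P.map (algebraMap F K)).eval a = 0 →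
      (P.map (algebraMap F K)).rootMultiplicity a = q ^ k) := by
  have : IsAlgClosed K := IsAlgClosure.isAlgClosed F
  have hq0 : 0 < q := hq.pos
  obtain ⟨p, s, hp, hs, rfl⟩ := (isPrimePow_nat_iff q).mp hq
  have : Fact p.Prime := ⟨hp⟩
  have : CharP F p := charP_of_card_eq_prime_pow (f := s * m) (by rw [hF, pow_mul])
  have : CharP K p := charP_of_injective_algebraMap (algebraMap F K).injective p
  have : ExpChar K p := .prime hp
  have hqK : ((p ^ s : ℕ) : K) = 0 := by simp [hs.ne']
  choose c hc using fun i =>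
    IsAlgClosed.exists_pow_nat_eq (algebraMap F K (f (k + i))) (pow_pos hq0 k)
  have hc_ne {i : ℕ} (hi : f (k + i) ≠ 0) : c i ≠ 0 := by
    intro h
    have := hc i
    rw [h, zero_pow (pow_pos hq0 k).ne'] at this
    exact hi ((map_eq_zero _).mp this.symm)
  have hc0 : c 0 ≠ 0 := hc_ne hfk
  have hcN : c (n - k) ≠ 0 := hc_ne (by rwa [Nat.add_sub_cancel' hkn])
  set R := qbrackPoly (p ^ s) c (n - k) with hR
  have hPR : P.map (algebraMap F K) = X ^ qbrack (p ^ s) k * R ^ (p ^ s) ^ k := by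
    rw [hR, ← sum_Icc_qbrack_eq hkn c (fun i => algebraMap F K (f i)) hc, hP]
    simp [Polynomial.map_sum]
  have hsep : R.Separable := separable_qbrackPoly hqK hc0
  have hR0 : (0 : K) ∉ R.roots := fun h => by
    have h0 : R.eval 0 = 0 := (mem_roots'.mp h).2
    rw [hR, qbrackPoly, Finset.sum_range_succ', eval_add, eval_finsetSum, Finset.sum_eq_zero] at h0
    · simp [qbrack_zero, hc0] at h0
    · intro i _
      simp [qbrack, Finset.sum_range_succ']
  have hcard : R.roots.card = qbrack (p ^ s) (n - k) := by
    rw [← natDegree_qbrackPoly hq0 hcN, (IsAlgClosed.splits R).natDegree_eq_card_roots]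
  have hroots : (P.map (algebraMap F K)).roots =
      qbrack (p ^ s) k • {0} + ((p ^ s) ^ k) • R.roots := by
    rw [hPR, roots_mul (mul_ne_zero (pow_ne_zero _ X_ne_zero) (pow_ne_zero _ hsep.ne_zero)),
      roots_pow, roots_pow, roots_X]
  have hP0 : P.map (algebraMap F K) ≠ 0 :=
    hPR ▸ mul_ne_zero (pow_ne_zero _ X_ne_zero) (pow_ne_zero _ hsep.ne_zero)
  have hmem {a : K} (ha : a ≠ 0) : a ∈ (P.map (algebraMap F K)).roots ↔ a ∈ R.roots := by
    simp [hroots, Multiset.mem_nsmul, ha, hp.ne_zero]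
  refine ⟨?_, ?_, fun a ha hroot => ?_⟩
  · rw [← count_roots, hroots]
    simp [Multiset.count_eq_zero_of_notMem hR0]
  · rw [← hcard, ← Multiset.toFinset_card_of_nodup (nodup_roots hsep)]
    congr 1
    ext a
    rw [Finset.mem_erase, Multiset.mem_toFinset, Multiset.mem_toFinset]
    exact ⟨fun h => (hmem h.1).mp h.2, fun h =>
      have ha : a ≠ 0 := fun h0 => hR0 (h0 ▸ h)
      ⟨ha, (hmem ha).mpr h⟩⟩
  · have haR : a ∈ R.roots := (hmem ha).mp ((mem_roots hP0).mpr hroot)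
    rw [← count_roots, hroots]
    simp [Multiset.count_eq_one_of_mem (nodup_roots hsep) haR, ha]
end
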